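/- arXiv:1311.6607 — 2 statements merged into one kernel-verified Lean document; each statement's English description precedes it below -/
import Mathlib

section
/- For every α ∈ (0,1) with T(α) ≤ 0, one has c(α,τ) > 0 for all τ ∈ (−1,0). (In the notation of the paper, this is the statement that c(τ) > 0 on (−1,0) whenever α ∈ [α₀,1), where α₀ is the unique zero of T in (0,1).) -/
open MeasureTheory Real Set

noncomputable def c (α τ : ℝ) : ℝ :=
  ∫ t in Set.Ioi (0:ℝ), (|1 - t| ^ τ + (1 + t) ^ τ - 2) / t ^ (1 + 2 * α)

noncomputable def T (α : ℝ) : ℝ :=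
  ∫ t in Set.Ioi (0:ℝ), Real.log |1 - t ^ 2| / t ^ (1 + 2 * α)

lemma log_abs_one_sub_sq {t : ℝ} (h0 : 0 < t) (h1 : t ≠ 1) :
    log |1 - t ^ 2| = log |1 - t| + log (1 + t) := by
  rw [← Real.log_mul (abs_ne_zero.2 (sub_ne_zero.2 h1.symm)) (by positivity),
    show 1 - t ^ 2 = (1 - t) * (1 + t) by ring, abs_mul, abs_of_pos (show 0 < 1 + t by positivity)]

lemma mul_log_lt_rpow_sub_one {x : ℝ} (hx : 0 < x) (hx1 : x ≠ 1) {τ : ℝ} (hτ : τ ≠ 0) :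
    τ * log x < x ^ τ - 1 := by
  have h := Real.add_one_lt_exp (mul_ne_zero (Real.log_ne_zero_of_pos_of_ne_one hx hx1) hτ)
  rw [Real.rpow_def_of_pos hx]
  linarith

lemma mul_log_le_rpow_sub_one {x : ℝ} (hx : 0 < x) (τ : ℝ) : τ * log x ≤ x ^ τ - 1 := by
  rw [Real.rpow_def_of_pos hx]
  linarith [Real.add_one_le_exp (log x * τ)]

lemma mul_log_div_lt {t α τ : ℝ} (h0 : 0 < t) (h1 : t ≠ 1) (hτ : τ ≠ 0) :
    τ * (log |1 - t ^ 2| / t ^ (1 + 2 * α)) <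
      (|1 - t| ^ τ + (1 + t) ^ τ - 2) / t ^ (1 + 2 * α) := by
  rw [log_abs_one_sub_sq h0 h1, ← mul_div_assoc]
  have hlow := mul_log_le_rpow_sub_one (abs_pos.2 (sub_ne_zero.2 h1.symm)) τ
  have hupp := mul_log_lt_rpow_sub_one (show 0 < 1 + t by positivity) (by linarith) hτ
  gcongr
  linarith

lemma abs_rpow_add_rpow_sub_two_le {t τ : ℝ} (h0 : 0 < t) (h1 : t ≤ 1 / 2) (hτ : |τ| ≤ 1) :
    |(|1 - t| ^ τ + (1 + t) ^ τ - 2)| ≤ 7 * t ^ 2 := by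
  have hpos : 0 < 1 - t := by linarith
  have hl1 : |log (1 - t)| ≤ 2 * t := by
    rw [abs_of_nonpos (Real.log_nonpos hpos.le (by linarith))]
    have h := Real.one_sub_inv_le_log_of_pos hpos
    have hinv : (1 - t)⁻¹ ≤ 1 + 2 * t := by
      rw [inv_le_iff_one_le_mul₀ hpos]; nlinarith
    linarith
  have hl2 : |log (1 + t)| ≤ t := by
    rw [abs_of_nonneg (Real.log_nonneg (by linarith))]
    linarith [Real.log_le_sub_one_of_pos (show 0 < 1 + t by linarith)]
  have hl3 : |log (1 - t) + log (1 + t)| ≤ 2 * t ^ 2 := by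
    have hp : 0 < 1 - t ^ 2 := by nlinarith
    rw [← Real.log_mul hpos.ne' (by positivity), show (1 - t) * (1 + t) = 1 - t ^ 2 by ring,
      abs_of_nonpos (Real.log_nonpos hp.le (by nlinarith))]
    have h := Real.one_sub_inv_le_log_of_pos hp
    have hinv : (1 - t ^ 2)⁻¹ ≤ 1 + 2 * t ^ 2 := by
      rw [inv_le_iff_one_le_mul₀ hp]
      nlinarith [mul_nonneg (sq_nonneg t) (show 0 ≤ 1 - 2 * t ^ 2 by nlinarith)]
    linarith
  have hx1 : |log (1 - t) * τ| ≤ 2 * t := by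
    rw [abs_mul]; nlinarith [abs_nonneg (log (1 - t))]
  have hx2 : |log (1 + t) * τ| ≤ t := by
    rw [abs_mul]; nlinarith [abs_nonneg (log (1 + t))]
  have hx3 : |log (1 - t) * τ + log (1 + t) * τ| ≤ 2 * t ^ 2 := by
    rw [← add_mul, abs_mul]; nlinarith [abs_nonneg (log (1 - t) + log (1 + t))]
  have he1 := Real.abs_exp_sub_one_sub_id_le (hx1.trans (by linarith))
  have he2 := Real.abs_exp_sub_one_sub_id_le (hx2.trans (by linarith))
  have hs1 := sq_le_sq' (abs_le.1 hx1).1 (abs_le.1 hx1).2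
  have hs2 := sq_le_sq' (abs_le.1 hx2).1 (abs_le.1 hx2).2
  rw [abs_of_pos hpos, Real.rpow_def_of_pos hpos, Real.rpow_def_of_pos (by linarith : 0 < 1 + t)]
  rw [abs_le] at *
  constructor <;> nlinarith

lemma abs_rpow_add_rpow_sub_two_le_rpow {t τ σ : ℝ} (ht : 2 < t) (hτ : τ ≤ σ) (h0 : 0 ≤ σ)
    (h1 : σ ≤ 1) : |(|1 - t| ^ τ + (1 + t) ^ τ - 2)| ≤ 5 * t ^ σ := by
  have ha : |1 - t| = t - 1 := by rw [abs_sub_comm, abs_of_pos (by linarith)]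
  have hlow : (t - 1) ^ τ ≤ t ^ σ :=
    (Real.rpow_le_rpow_of_exponent_le (by linarith) hτ).trans
      (Real.rpow_le_rpow (by linarith) (by linarith) h0)
  have htwo : (2:ℝ) ^ σ ≤ 2 := by
    simpa using Real.rpow_le_rpow_of_exponent_le (one_le_two (α := ℝ)) h1
  have hone : 1 ≤ t ^ σ := Real.one_le_rpow (by linarith) h0
  have hupp : (1 + t) ^ τ ≤ 2 * t ^ σ :=
    calc (1 + t) ^ τ ≤ (1 + t) ^ σ := Real.rpow_le_rpow_of_exponent_le (by linarith) hτ
      _ ≤ (2 * t) ^ σ := Real.rpow_le_rpow (by linarith) (by linarith) h0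
      _ = 2 ^ σ * t ^ σ := Real.mul_rpow (by norm_num) (by linarith)
      _ ≤ 2 * t ^ σ := by gcongr
  have hp1 : 0 ≤ (t - 1) ^ τ := Real.rpow_nonneg (by linarith) _
  have hp2 : 0 ≤ (1 + t) ^ τ := Real.rpow_nonneg (by linarith) _
  rw [ha, abs_le]
  constructor <;> linarith

lemma intervalIntegrable_abs_rpow {τ : ℝ} (hτ : -1 < τ) (a b : ℝ) :
    IntervalIntegrable (fun t : ℝ => |t| ^ τ) volume a b := by
  have hright : ∀ x : ℝ, 0 ≤ x → IntervalIntegrable (fun t : ℝ => |t| ^ τ) volume 0 x := by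
    intro x hx
    refine (intervalIntegral.intervalIntegrable_rpow' (a := 0) (b := x) hτ).congr ?_
    intro t ht
    rw [uIoc_of_le hx] at ht
    simp [abs_of_pos ht.1]
  have hall : ∀ x : ℝ, IntervalIntegrable (fun t : ℝ => |t| ^ τ) volume 0 x := by
    intro x
    rcases le_total 0 x with hx | hx
    · exact hright x hx
    · simpa using (hright (-x) (neg_nonneg.2 hx)).comp_sub_left 0
  exact (hall a).symm.trans (hall b)

lemma integrableOn_c_integrand {α τ : ℝ} (hα : α ∈ Ioo (0:ℝ) 1) (hτ : -1 < τ) (hτα : τ ≤ α) :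
    IntegrableOn (fun t : ℝ => (|1 - t| ^ τ + (1 + t) ^ τ - 2) / t ^ (1 + 2 * α)) (Ioi 0) := by
  obtain ⟨hα0, hα1⟩ := hα
  have hmeas : Measurable
      (fun t : ℝ => (|1 - t| ^ τ + (1 + t) ^ τ - 2) / t ^ (1 + 2 * α)) := by fun_prop
  have hnear : IntegrableOn
      (fun t : ℝ => (|1 - t| ^ τ + (1 + t) ^ τ - 2) / t ^ (1 + 2 * α)) (Ioc 0 (1 / 2)) := by
    have hdom : IntegrableOn (fun t : ℝ => 7 * t ^ (1 - 2 * α)) (Ioc 0 (1 / 2)) :=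
      ((intervalIntegrable_iff_integrableOn_Ioc_of_le (by norm_num)).1
        (intervalIntegral.intervalIntegrable_rpow' (by linarith))).const_mul 7
    refine hdom.mono' hmeas.aestronglyMeasurable ?_
    filter_upwards [ae_restrict_mem measurableSet_Ioc] with t ht
    have hp : 0 < t ^ (1 + 2 * α) := Real.rpow_pos_of_pos ht.1 _
    rw [Real.norm_eq_abs, abs_div, abs_of_pos hp, div_le_iff₀ hp, mul_assoc,
      ← Real.rpow_add ht.1]
    rw [show 1 - 2 * α + (1 + 2 * α) = (2 : ℕ) by push_cast; ring, Real.rpow_natCast]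
    exact abs_rpow_add_rpow_sub_two_le ht.1 ht.2 (abs_le.2 ⟨hτ.le, by linarith⟩)
  have hmid : IntegrableOn
      (fun t : ℝ => (|1 - t| ^ τ + (1 + t) ^ τ - 2) / t ^ (1 + 2 * α)) (Icc (1 / 2) 2) := by
    have hsing : IntegrableOn (fun t : ℝ => |1 - t| ^ τ) (Icc (1 / 2) 2) := by
      rw [integrableOn_Icc_iff_integrableOn_Ioc,
        ← intervalIntegrable_iff_integrableOn_Ioc_of_le (by norm_num)]
      simpa [abs_sub_comm] using
        (intervalIntegrable_abs_rpow hτ (1 / 2 - 1) (2 - 1)).comp_sub_right 1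
    have hreg : ContinuousOn (fun t : ℝ => (1 + t) ^ τ - 2) (Icc (1 / 2) 2) := by
      refine ContinuousOn.sub (ContinuousOn.rpow_const (by fun_prop) ?_) continuousOn_const
      intro t ht
      exact Or.inl (by linarith [ht.1])
    have hker : ContinuousOn (fun t : ℝ => (t ^ (1 + 2 * α))⁻¹) (Icc (1 / 2) 2) := by
      refine ContinuousOn.inv₀ (ContinuousOn.rpow_const continuousOn_id ?_) ?_
      · intro t ht
        exact Or.inr (by linarith)
      · intro t ht
        exact (Real.rpow_pos_of_pos (by linarith [ht.1]) _).ne'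
    refine ((hsing.add hreg.integrableOn_Icc).mul_continuousOn hker isCompact_Icc).congr_fun
      (fun t _ => ?_) measurableSet_Icc
    simp only [Pi.add_apply]
    rw [div_eq_mul_inv, add_sub_assoc]
  have hfar : IntegrableOn
      (fun t : ℝ => (|1 - t| ^ τ + (1 + t) ^ τ - 2) / t ^ (1 + 2 * α)) (Ioi 2) := by
    have hdom : IntegrableOn (fun t : ℝ => 5 * t ^ (-1 - α)) (Ioi 2) :=
      (integrableOn_Ioi_rpow_of_lt (by linarith) (by norm_num)).const_mul 5
    refine hdom.mono' hmeas.aestronglyMeasurable ?_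
    filter_upwards [ae_restrict_mem measurableSet_Ioi] with t ht
    have ht0 : 0 < t := lt_trans two_pos ht
    have hp : 0 < t ^ (1 + 2 * α) := Real.rpow_pos_of_pos ht0 _
    rw [Real.norm_eq_abs, abs_div, abs_of_pos hp, div_le_iff₀ hp, mul_assoc,
      ← Real.rpow_add ht0]
    rw [show -1 - α + (1 + 2 * α) = α by ring]
    exact abs_rpow_add_rpow_sub_two_le_rpow ht hτα hα0.le hα1.le
  refine ((hnear.union hmid).union hfar).mono_set fun t ht => ?_
  rcases le_or_gt t (1 / 2) with h | h
  · exact Or.inl (Or.inl ⟨ht, h⟩)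
  · rcases le_or_gt t 2 with h' | h'
    · exact Or.inl (Or.inr ⟨h.le, h'⟩)
    · exact Or.inr h'

lemma ae_restrict_Ioi_pos_and_ne_one :
    ∀ᵐ t ∂(volume.restrict (Ioi (0:ℝ))), 0 < t ∧ t ≠ 1 := by
  filter_upwards [ae_restrict_mem measurableSet_Ioi,
    ae_restrict_of_ae (Measure.ae_ne volume (1:ℝ))] with t h0 h1
  exact ⟨h0, h1⟩

lemma integrableOn_T_integrand {α : ℝ} (hα : α ∈ Ioo (0:ℝ) 1) :
    IntegrableOn (fun t : ℝ => log |1 - t ^ 2| / t ^ (1 + 2 * α)) (Ioi 0) := by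
  have hneg : -1 < -(1 / 2 : ℝ) := by norm_num
  have hmeas : Measurable (fun t : ℝ => log |1 - t ^ 2| / t ^ (1 + 2 * α)) := by fun_prop
  refine integrable_of_le_of_le hmeas.aestronglyMeasurable ?_ ?_
    ((integrableOn_c_integrand hα hneg (by linarith [hα.1])).const_mul (-2))
    ((integrableOn_c_integrand hα (by linarith [hα.1]) le_rfl).const_mul α⁻¹)
  · filter_upwards [ae_restrict_Ioi_pos_and_ne_one] with t ht
    linarith [mul_log_div_lt (α := α) ht.1 ht.2 (show -(1 / 2 : ℝ) ≠ 0 by norm_num)]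
  · filter_upwards [ae_restrict_Ioi_pos_and_ne_one] with t ht
    rw [inv_mul_eq_div, le_div_iff₀' hα.1]
    exact (mul_log_div_lt ht.1 ht.2 hα.1.ne').le

theorem c_pos_of_T_nonpos (α : ℝ) (hα : α ∈ Set.Ioo (0:ℝ) 1) (hT : T α ≤ 0) :
    ∀ τ ∈ Set.Ioo (-1:ℝ) 0, 0 < c α τ := by
  intro τ hτ
  have hc := integrableOn_c_integrand hα hτ.1 (hτ.2.le.trans hα.1.le)
  have hlog := (integrableOn_T_integrand hα).const_mul τ
  have hlt : τ * T α < c α τ := by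
    rw [T, c, ← integral_const_mul, ← sub_pos, ← integral_sub hc hlog]
    have hpos : ∀ᵐ t ∂(volume.restrict (Ioi (0:ℝ))),
        0 < (|1 - t| ^ τ + (1 + t) ^ τ - 2) / t ^ (1 + 2 * α) -
          τ * (log |1 - t ^ 2| / t ^ (1 + 2 * α)) := by
      filter_upwards [ae_restrict_Ioi_pos_and_ne_one] with t ht
      exact sub_pos.2 (mul_log_div_lt ht.1 ht.2 hτ.2.ne)
    refine (integral_nonneg_of_ae (hpos.mono fun t ht => ht.le)).lt_of_ne' fun h0 => ?_
    rw [integral_eq_zero_iff_of_nonneg_ae (hpos.mono fun t ht => ht.le) (hc.sub hlog)] at h0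
    have : NeZero (volume.restrict (Ioi (0:ℝ))) := ⟨by simp⟩
    obtain ⟨t, h1, h2⟩ := (hpos.and h0).exists
    exact h1.ne' h2
  exact (mul_nonneg_of_nonpos_of_nonpos hτ.2.le hT).trans_lt hlt
end

section
/- For every α ∈ (0,1) with T(α) > 0, there exists a unique τ₁ ∈ (−1,0) such that c(α,τ₁) = 0; moreover c(α,τ) > 0 for all τ ∈ (−1,τ₁) and c(α,τ) < 0 for all τ ∈ (τ₁,0). (In the notation of the paper, this is the statement for α ∈ (0,α₀), where α₀ is the unique zero of T in (0,1), and τ₁ = τ₁(α).) -/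
open MeasureTheory Real Set

lemma numerator_nonneg {τ t : ℝ} (hτ : τ ≤ 0) (h0 : 0 < t) (h1 : t < 1) :
    0 ≤ |1 - t| ^ τ + (1 + t) ^ τ - 2 := by
  rw [abs_of_pos (by linarith)]
  have ha : 0 < (1 - t) ^ τ := rpow_pos_of_pos (by linarith) _
  have hb : 0 < (1 + t) ^ τ := rpow_pos_of_pos (by linarith) _
  have hab : 1 ≤ (1 - t) ^ τ * (1 + t) ^ τ := by
    rw [← mul_rpow (by linarith) (by linarith)]
    exact one_le_rpow_of_pos_of_le_one_of_nonpos (by nlinarith) (by nlinarith) hτ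
  nlinarith [sq_nonneg ((1 - t) ^ τ - (1 + t) ^ τ)]

lemma rpow_convex_combination_le {x σ τ a b : ℝ} (hx : 0 < x) (ha : 0 ≤ a) (hb : 0 ≤ b)
    (hab : a + b = 1) : x ^ (a * σ + b * τ) ≤ a * x ^ σ + b * x ^ τ :=
  (convexOn_rpow_left hx).2 (mem_univ σ) (mem_univ τ) ha hb hab

lemma numerator_le_sq {τ t : ℝ} (hτ : -1 < τ) (hτ' : τ ≤ 0) (h0 : 0 < t) (h1 : t ≤ 1 / 2) :
    |1 - t| ^ τ + (1 + t) ^ τ - 2 ≤ 4 * t ^ 2 := by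
  rw [abs_of_pos (by linarith)]
  have key : ∀ x : ℝ, 0 < x → x ^ τ ≤ (-τ) * x⁻¹ + (1 + τ) := fun x hx => by
    have h := rpow_convex_combination_le (σ := -1) (τ := 0) hx
      (neg_nonneg.2 hτ') (by linarith : 0 ≤ 1 + τ) (by ring)
    rw [rpow_neg_one, rpow_zero] at h
    convert h using 2 <;> ring
  have e1 := key (1 - t) (by linarith)
  have e2 := key (1 + t) (by linarith)
  have e3 : (1 - t)⁻¹ + (1 + t)⁻¹ - 2 ≤ 4 * t ^ 2 := by
    have : (1 - t)⁻¹ + (1 + t)⁻¹ - 2 = 2 * t ^ 2 / (1 - t ^ 2) := by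
      have : 1 - t ≠ 0 := by linarith
      have : 1 + t ≠ 0 := by linarith
      have : 1 - t ^ 2 ≠ 0 := by nlinarith
      field_simp
      ring
    rw [this, div_le_iff₀ (by nlinarith)]
    have : t ^ 2 ≤ 1 / 2 := by nlinarith
    nlinarith [mul_nonneg (sq_nonneg t) (sub_nonneg.2 this)]
  nlinarith [mul_le_mul_of_nonneg_left e3 (neg_nonneg.2 hτ'), sq_nonneg t]

lemma measurable_integrand (α τ : ℝ) :
    Measurable fun t : ℝ => (|1 - t| ^ τ + (1 + t) ^ τ - 2) / t ^ (1 + 2 * α) := by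
  fun_prop

lemma integrableOn_integrand {α τ : ℝ} (hα : α ∈ Ioo (0 : ℝ) 1) (hτ : τ ∈ Ioc (-1 : ℝ) 0) :
    IntegrableOn (fun t : ℝ => (|1 - t| ^ τ + (1 + t) ^ τ - 2) / t ^ (1 + 2 * α)) (Ioi 0) := by
  obtain ⟨hα0, hα1⟩ := hα
  obtain ⟨hτ1, hτ0⟩ := hτ
  have near_zero : IntegrableOn
      (fun t : ℝ => (|1 - t| ^ τ + (1 + t) ^ τ - 2) / t ^ (1 + 2 * α)) (Ioc 0 (1 / 2)) := by
    have hg : IntegrableOn (fun t : ℝ => 4 * t ^ (1 - 2 * α)) (Ioc 0 (1 / 2)) :=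
      ((intervalIntegrable_iff_integrableOn_Ioc_of_le (by norm_num)).1
        (intervalIntegral.intervalIntegrable_rpow' (by linarith))).const_mul 4
    refine hg.mono' (measurable_integrand α τ).aestronglyMeasurable ?_
    refine (ae_restrict_iff' measurableSet_Ioc).2 (.of_forall fun t ht => ?_)
    have hp : 0 < t ^ (1 + 2 * α) := rpow_pos_of_pos ht.1 _
    have hn := numerator_nonneg hτ0 ht.1 (by linarith [ht.2])
    rw [norm_of_nonneg (div_nonneg hn hp.le), div_le_iff₀ hp, mul_assoc, ← rpow_add ht.1]
    rw [show 1 - 2 * α + (1 + 2 * α) = 2 by ring, rpow_two]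
    exact numerator_le_sq hτ1 hτ0 ht.1 ht.2
  have near_one : IntegrableOn
      (fun t : ℝ => (|1 - t| ^ τ + (1 + t) ^ τ - 2) / t ^ (1 + 2 * α)) (Ioc (1 / 2) 2) := by
    have hleft : IntervalIntegrable (fun t : ℝ => |1 - t| ^ τ) volume (1 / 2) 1 := by
      have h : IntervalIntegrable (fun t : ℝ => (1 - t) ^ τ) volume (1 / 2) 1 := by
        have := (intervalIntegral.intervalIntegrable_rpow' (a := 1 / 2) (b := 0) hτ1).comp_sub_left 1
        norm_num at this ⊢
        exact this
      refine h.congr fun t ht => ?_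
      rw [uIoc_of_le (by norm_num)] at ht
      simp only [abs_of_nonneg (sub_nonneg.2 ht.2)]
    have hright : IntervalIntegrable (fun t : ℝ => |1 - t| ^ τ) volume 1 2 := by
      have h : IntervalIntegrable (fun t : ℝ => (t - 1) ^ τ) volume 1 2 := by
        have := (intervalIntegral.intervalIntegrable_rpow' (a := 0) (b := 1) hτ1).comp_sub_right 1
        norm_num at this ⊢
        exact this
      refine h.congr fun t ht => ?_
      rw [uIoc_of_le (by norm_num)] at ht
      simp only [abs_sub_comm 1 t, abs_of_pos (sub_pos.2 ht.1)]
    have hpos : ∀ t ∈ uIcc (1 / 2 : ℝ) 2, 0 < t := fun t ht => by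
      rw [uIcc_of_le (by norm_num)] at ht
      linarith [ht.1]
    have hrest : IntervalIntegrable (fun t : ℝ => (1 + t) ^ τ - 2) volume (1 / 2) 2 := by
      refine ContinuousOn.intervalIntegrable fun t ht => ContinuousAt.continuousWithinAt ?_
      have := hpos t ht
      exact ((continuousAt_const.add continuousAt_id).rpow_const
        (Or.inl (by simp; linarith))).sub continuousAt_const
    have hden : ContinuousOn (fun t : ℝ => (t ^ (1 + 2 * α))⁻¹) (uIcc (1 / 2) 2) := fun t ht =>
      ContinuousAt.continuousWithinAt <| (continuousAt_id.rpow_const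
        (Or.inl (hpos t ht).ne')).inv₀ (rpow_pos_of_pos (hpos t ht) _).ne'
    have := (((hleft.trans hright).add hrest).mul_continuousOn hden)
    rw [intervalIntegrable_iff_integrableOn_Ioc_of_le (by norm_num)] at this
    refine this.congr_fun (fun t _ => ?_) measurableSet_Ioc
    simp only [div_eq_mul_inv]
    ring
  have at_infinity : IntegrableOn
      (fun t : ℝ => (|1 - t| ^ τ + (1 + t) ^ τ - 2) / t ^ (1 + 2 * α)) (Ioi 2) := by
    have hg : IntegrableOn (fun t : ℝ => 2 * t ^ (-(1 + 2 * α))) (Ioi 2) :=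
      (integrableOn_Ioi_rpow_of_lt (by linarith) (by norm_num)).const_mul 2
    refine hg.mono' (measurable_integrand α τ).aestronglyMeasurable ?_
    refine (ae_restrict_iff' measurableSet_Ioi).2 (.of_forall fun t ht => ?_)
    have ht : 2 < t := ht
    have hp : 0 < t ^ (1 + 2 * α) := rpow_pos_of_pos (by linarith) _
    rw [rpow_neg (by linarith), ← div_eq_mul_inv, norm_div, norm_of_nonneg hp.le]
    gcongr
    have habs : |1 - t| = t - 1 := by rw [abs_sub_comm, abs_of_pos (by linarith)]
    rw [habs, Real.norm_eq_abs, abs_le]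
    have := rpow_pos_of_pos (by linarith : 0 < t - 1) τ
    have := rpow_pos_of_pos (by linarith : 0 < 1 + t) τ
    have := rpow_le_one_of_one_le_of_nonpos (by linarith : 1 ≤ t - 1) hτ0
    have := rpow_le_one_of_one_le_of_nonpos (by linarith : 1 ≤ 1 + t) hτ0
    constructor <;> linarith
  have hunion := (near_zero.union near_one).union at_infinity
  rwa [Ioc_union_Ioc_eq_Ioc (by norm_num) (by norm_num), Ioc_union_Ioi_eq_Ioi (by norm_num)]
    at hunion

lemma ae_pos_and_ne_one : ∀ᵐ t ∂(volume.restrict (Ioi (0 : ℝ))), 0 < t ∧ t ≠ 1 := by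
  filter_upwards [ae_restrict_mem measurableSet_Ioi,
    ae_restrict_of_ae (Measure.ae_ne volume (1 : ℝ))] with t h0 h1
  exact ⟨h0, h1⟩

lemma convexOn_c {α : ℝ} (hα : α ∈ Ioo (0 : ℝ) 1) : ConvexOn ℝ (Ioc (-1) 0) (c α) := by
  refine ⟨convex_Ioc _ _, fun σ hσ τ hτ a b ha hb hab => ?_⟩
  simp only [c, smul_eq_mul]
  have hστ : a * σ + b * τ ∈ Ioc (-1 : ℝ) 0 := convex_Ioc (-1 : ℝ) 0 hσ hτ ha hb hab
  rw [← integral_const_mul, ← integral_const_mul, ← integral_add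
    ((integrableOn_integrand hα hσ).const_mul a) ((integrableOn_integrand hα hτ).const_mul b)]
  refine integral_mono_ae (integrableOn_integrand hα hστ)
    (((integrableOn_integrand hα hσ).const_mul a).add
      ((integrableOn_integrand hα hτ).const_mul b)) ?_
  filter_upwards [ae_pos_and_ne_one] with t ⟨h0, h1⟩
  have hp : 0 < t ^ (1 + 2 * α) := rpow_pos_of_pos h0 _
  have e1 := rpow_convex_combination_le (σ := σ) (τ := τ)
    (abs_pos.2 (sub_ne_zero.2 h1.symm)) ha hb hab
  have e2 := rpow_convex_combination_le (σ := σ) (τ := τ)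
    (by linarith : 0 < 1 + t) ha hb hab
  rw [← mul_div_assoc, ← mul_div_assoc, ← add_div]
  gcongr
  nlinarith

lemma c_zero (α : ℝ) : c α 0 = 0 := by
  simp only [c, rpow_zero]
  norm_num

lemma exists_c_pos {α : ℝ} (hα : α ∈ Ioo (0 : ℝ) 1) : ∀ τ₀ ∈ Ioo (-1 : ℝ) 0,
    ∃ τ ∈ Ioo (-1 : ℝ) τ₀, 0 < c α τ := by
  intro τ₀ hτ₀
  have hα0 := hα.1
  set K : ℝ := 2 ^ (1 + 2 * α)
  have hKpos : 0 < K := rpow_pos_of_pos two_pos _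
  have lower : ∀ τ ∈ Ioo (-1 : ℝ) 0, K⁻¹ * (1 / (1 + τ)) - 1 / α ≤ c α τ := by
    intro τ hτ
    have hsing : IntervalIntegrable (fun t : ℝ => (t - 1) ^ τ) volume 1 2 := by
      have := (intervalIntegral.intervalIntegrable_rpow' (a := 0) (b := 1) hτ.1).comp_sub_right 1
      norm_num at this ⊢
      exact this
    have hsing_eq : ∫ t in Ioc (1 : ℝ) 2, K⁻¹ * (t - 1) ^ τ = K⁻¹ * (1 / (1 + τ)) := by
      rw [integral_const_mul, ← intervalIntegral.integral_of_le (by norm_num),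
        intervalIntegral.integral_comp_sub_right (fun x : ℝ => x ^ τ) 1,
        integral_rpow (Or.inl hτ.1), show (2 : ℝ) - 1 = 1 by norm_num, sub_self, one_rpow,
        zero_rpow (by linarith [hτ.1]), sub_zero, add_comm τ]
    have htail_eq : ∫ t in Ioi (1 : ℝ), 2 * t ^ (-(1 + 2 * α)) = 1 / α := by
      rw [integral_const_mul, integral_Ioi_rpow_of_lt (by linarith) one_pos, one_rpow,
        show -(1 + 2 * α) + 1 = -(2 * α) by ring]
      field_simp
    have hi1 : Integrable ((Ioc (1 : ℝ) 2).indicator fun t => K⁻¹ * (t - 1) ^ τ)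
        (volume.restrict (Ioi 0)) :=
      (IntegrableOn.integrable_indicator (((intervalIntegrable_iff_integrableOn_Ioc_of_le
        (by norm_num)).1 hsing).const_mul K⁻¹) measurableSet_Ioc).restrict
    have hi2 : Integrable ((Ioi (1 : ℝ)).indicator fun t => 2 * t ^ (-(1 + 2 * α)))
        (volume.restrict (Ioi 0)) :=
      (IntegrableOn.integrable_indicator ((integrableOn_Ioi_rpow_of_lt
        (by linarith : -(1 + 2 * α) < -1) one_pos).const_mul 2) measurableSet_Ioi).restrict
    have hsub : Ioc (1 : ℝ) 2 ⊆ Ioi 0 := fun t ht => lt_trans one_pos ht.1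
    rw [← hsing_eq, ← htail_eq, ← inter_eq_right.2 hsub,
      ← inter_eq_right.2 (Ioi_subset_Ioi zero_le_one : Ioi (1 : ℝ) ⊆ Ioi 0),
      ← setIntegral_indicator measurableSet_Ioc, ← setIntegral_indicator measurableSet_Ioi,
      ← integral_sub hi1 hi2]
    refine integral_mono_ae (hi1.sub hi2)
      (integrableOn_integrand hα ⟨hτ.1, hτ.2.le⟩) ?_
    filter_upwards [ae_pos_and_ne_one] with t ⟨h0, h1⟩
    have hp : 0 < t ^ (1 + 2 * α) := rpow_pos_of_pos h0 _
    rcases lt_or_gt_of_ne h1 with h | h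
    · rw [indicator_of_notMem (fun h' => h.not_gt h'.1),
        indicator_of_notMem (notMem_Ioi.2 h.le), sub_zero]
      exact div_nonneg (numerator_nonneg hτ.2.le h0 h) hp.le
    · have ha : 0 < (t - 1) ^ τ := rpow_pos_of_pos (by linarith) _
      have hb : 0 < (1 + t) ^ τ := rpow_pos_of_pos (by linarith) _
      rw [indicator_of_mem (show t ∈ Ioi (1 : ℝ) from h), rpow_neg h0.le,
        abs_sub_comm, abs_of_pos (sub_pos.2 h), ← div_eq_mul_inv, sub_div]
      gcongr
      by_cases h2 : t ≤ 2
      · rw [indicator_of_mem (show t ∈ Ioc (1 : ℝ) 2 from ⟨h, h2⟩), inv_mul_eq_div]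
        have hle : t ^ (1 + 2 * α) ≤ K := rpow_le_rpow h0.le h2 (by linarith)
        gcongr
        linarith
      · rw [indicator_of_notMem (fun h' => h2 h'.2)]
        positivity
  set δ : ℝ := min ((1 + τ₀) / 2) (α / (2 * K))
  have hδpos : 0 < δ := lt_min (by linarith [hτ₀.1]) (by positivity)
  have hδ1 : δ ≤ (1 + τ₀) / 2 := min_le_left _ _
  have hδ2 : δ ≤ α / (2 * K) := min_le_right _ _
  refine ⟨-1 + δ, ⟨by linarith, by linarith [hτ₀.1]⟩, ?_⟩
  refine lt_of_lt_of_le ?_ (lower (-1 + δ) ⟨by linarith, by linarith [hτ₀.1, hτ₀.2]⟩)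
  rw [show 1 + (-1 + δ) = δ by ring, sub_pos, inv_mul_eq_div, div_div, one_div_lt_one_div hα0
    (by positivity)]
  rw [le_div_iff₀ (by positivity)] at hδ2
  nlinarith

lemma slope_rpow_bounds {x τ : ℝ} (hx : 0 < x) (hτ : τ ∈ Ico (-1 / 2 : ℝ) 0) :
    (x ^ (-1 / 2 : ℝ) - 1) / (-1 / 2) ≤ (x ^ τ - 1) / τ ∧ (x ^ τ - 1) / τ ≤ log x := by
  obtain ⟨h1, h2⟩ := hτ
  constructor
  · rw [le_div_iff_of_neg h2]
    have h := rpow_convex_combination_le (σ := -1 / 2) (τ := 0) (a := -2 * τ) (b := 1 + 2 * τ) hx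
      (by linarith) (by linarith) (by ring)
    rw [rpow_zero, show -2 * τ * (-1 / 2) + (1 + 2 * τ) * 0 = τ by ring] at h
    linarith
  · rw [div_le_iff_of_neg h2, rpow_def_of_pos hx]
    linarith [add_one_le_exp (log x * τ)]

lemma tendsto_slope_rpow {x : ℝ} (hx : 0 < x) :
    Filter.Tendsto (fun τ : ℝ => (x ^ τ - 1) / τ) (nhdsWithin 0 (Iio 0)) (nhds (log x)) := by
  have h : HasDerivAt (fun τ : ℝ => x ^ τ) (log x) 0 := by
    simpa using (hasStrictDerivAt_const_rpow hx 0).hasDerivAt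
  have := h.hasDerivWithinAt (s := Iio 0)
  rw [hasDerivWithinAt_iff_tendsto_slope' (by simp)] at this
  refine this.congr fun τ => ?_
  simp [slope_def_field]

lemma tendsto_c_div {α : ℝ} (hα : α ∈ Ioo (0 : ℝ) 1)
    (hlog : IntegrableOn (fun t : ℝ => log |1 - t ^ 2| / t ^ (1 + 2 * α)) (Ioi 0)) :
    Filter.Tendsto (fun τ => c α τ / τ) (nhdsWithin 0 (Iio 0)) (nhds (T α)) := by
  simp only [c, T, ← integral_div]
  have log_eq : ∀ t : ℝ, 0 < t → t ≠ 1 → log |1 - t ^ 2| = log |1 - t| + log (1 + t) :=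
    fun t h0 h1 => by
      have h2 : 0 < 1 + t := by linarith
      rw [show 1 - t ^ 2 = (1 - t) * (1 + t) by ring, abs_mul, abs_of_pos h2,
        log_mul (abs_ne_zero.2 (sub_ne_zero.2 h1.symm)) h2.ne']
  have hhalf := (integrableOn_integrand hα
    (⟨by norm_num, by norm_num⟩ : (-1 / 2 : ℝ) ∈ Ioc (-1) 0)).div_const (-1 / 2)
  refine tendsto_integral_filter_of_dominated_convergence _ (.of_forall fun τ =>
    ((measurable_integrand α τ).div_const τ).aestronglyMeasurable) ?_ (hhalf.norm.add hlog.norm) ?_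
  · filter_upwards [Ico_mem_nhdsLT (by norm_num : (-1 / 2 : ℝ) < 0)] with τ hτ
    filter_upwards [ae_pos_and_ne_one] with t ⟨h0, h1⟩
    have hp : 0 < t ^ (1 + 2 * α) := rpow_pos_of_pos h0 _
    obtain ⟨a1, a2⟩ := slope_rpow_bounds (abs_pos.2 (sub_ne_zero.2 h1.symm)) hτ
    obtain ⟨b1, b2⟩ := slope_rpow_bounds (by linarith : 0 < 1 + t) hτ
    simp only [Pi.add_apply, Real.norm_eq_abs, log_eq t h0 h1]
    have lo : (|1 - t| ^ (-1 / 2 : ℝ) + (1 + t) ^ (-1 / 2 : ℝ) - 2) / t ^ (1 + 2 * α) / (-1 / 2) ≤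
        (|1 - t| ^ τ + (1 + t) ^ τ - 2) / t ^ (1 + 2 * α) / τ := by
      rw [div_right_comm, div_right_comm _ _ τ]
      refine div_le_div_of_nonneg_right ?_ hp.le
      convert add_le_add a1 b1 using 1 <;> ring
    have hi : (|1 - t| ^ τ + (1 + t) ^ τ - 2) / t ^ (1 + 2 * α) / τ ≤
        (log |1 - t| + log (1 + t)) / t ^ (1 + 2 * α) := by
      rw [div_right_comm]
      gcongr
      convert add_le_add a2 b2 using 1
      ring
    refine (abs_le_max_abs_abs lo hi).trans (max_le ?_ ?_)
    · exact le_add_of_nonneg_right (abs_nonneg _)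
    · exact le_add_of_nonneg_left (abs_nonneg _)
  · filter_upwards [ae_pos_and_ne_one] with t ⟨h0, h1⟩
    rw [log_eq t h0 h1]
    refine (((tendsto_slope_rpow (abs_pos.2 (sub_ne_zero.2 h1.symm))).add
      (tendsto_slope_rpow (by linarith : 0 < 1 + t))).div_const (t ^ (1 + 2 * α))).congr
      fun τ => ?_
    ring

lemma exists_c_neg {α : ℝ} (hα : α ∈ Ioo (0 : ℝ) 1) (hT : 0 < T α) :
    ∃ τ ∈ Ioo (-1 : ℝ) 0, c α τ < 0 := by
  have hlog : IntegrableOn (fun t : ℝ => log |1 - t ^ 2| / t ^ (1 + 2 * α)) (Ioi 0) :=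
    Integrable.of_integral_ne_zero hT.ne'
  obtain ⟨τ, h, hτ⟩ := (((tendsto_c_div hα hlog).eventually (lt_mem_nhds hT)).and
    (Ioo_mem_nhdsLT (by norm_num : (-1 : ℝ) < 0))).exists
  refine ⟨τ, hτ, ?_⟩
  rcases div_pos_iff.1 h with h | h
  · exact absurd h.2 hτ.2.not_gt
  · exact h.1

theorem exists_unique_zero_c (α : ℝ) (hα : α ∈ Set.Ioo (0:ℝ) 1) (hT : 0 < T α) :
    ∃ τ₁ ∈ Set.Ioo (-1:ℝ) 0, c α τ₁ = 0 ∧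
      (∀ τ ∈ Set.Ioo (-1:ℝ) τ₁, 0 < c α τ) ∧
      (∀ τ ∈ Set.Ioo τ₁ (0:ℝ), c α τ < 0) ∧
      (∀ τ ∈ Set.Ioo (-1:ℝ) 0, c α τ = 0 → τ = τ₁) := by
  obtain ⟨ν, hν, hνneg⟩ := exists_c_neg hα hT
  obtain ⟨σ, hσ, hσpos⟩ := exists_c_pos hα ν hν
  have hconv := convexOn_c hα
  have hcont : ContinuousOn (c α) (Icc σ ν) :=
    ((hconv.subset Ioo_subset_Ioc_self (convex_Ioo _ _)).continuousOn isOpen_Ioo).mono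
      fun t ht => ⟨hσ.1.trans_le ht.1, ht.2.trans_lt hν.2⟩
  obtain ⟨τ₁, hτ₁, hzero⟩ := intermediate_value_Ioo' hσ.2.le hcont ⟨hνneg, hσpos⟩
  have hτ₁mem : τ₁ ∈ Ioo (-1 : ℝ) 0 := ⟨hσ.1.trans hτ₁.1, hτ₁.2.trans hν.2⟩
  have combination : ∀ x ∈ Ioc (-1 : ℝ) 0, ∀ z ∈ Ioc (-1 : ℝ) 0, ∀ y ∈ Ioo x z,
      (z - x) * c α y ≤ (z - y) * c α x + (y - x) * c α z := fun x hx z hz y hy => by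
    have hxz : 0 < z - x := sub_pos.2 (hy.1.trans hy.2)
    have h := hconv.2 hx hz (div_nonneg (sub_nonneg.2 hy.2.le) hxz.le)
      (div_nonneg (sub_nonneg.2 hy.1.le) hxz.le) (by field_simp; ring)
    have e : ((z - y) / (z - x)) • x + ((y - x) / (z - x)) • z = y := by
      simp only [smul_eq_mul]
      field_simp
      ring
    rw [e, smul_eq_mul, smul_eq_mul, div_mul_eq_mul_div, div_mul_eq_mul_div, ← add_div,
      le_div_iff₀ hxz] at h
    linarith
  have hpos : ∀ τ ∈ Ioo (-1 : ℝ) τ₁, 0 < c α τ := fun τ hτ => by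
    have h := combination τ ⟨hτ.1, (hτ.2.trans hτ₁mem.2).le⟩ ν ⟨hν.1, hν.2.le⟩ τ₁ ⟨hτ.2, hτ₁.2⟩
    have := mul_neg_of_pos_of_neg (sub_pos.2 hτ.2) hνneg
    rw [hzero, mul_zero] at h
    exact pos_of_mul_pos_right (by linarith) (sub_pos.2 hτ₁.2).le
  have hneg : ∀ τ ∈ Ioo τ₁ (0 : ℝ), c α τ < 0 := fun τ hτ => by
    rcases lt_trichotomy τ ν with hlt | rfl | hgt
    · have h := combination τ₁ ⟨hτ₁mem.1, hτ₁mem.2.le⟩ ν ⟨hν.1, hν.2.le⟩ τ ⟨hτ.1, hlt⟩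
      have := mul_neg_of_pos_of_neg (sub_pos.2 hτ.1) hνneg
      rw [hzero, mul_zero] at h
      exact neg_of_mul_neg_right (by linarith) (sub_pos.2 hτ₁.2).le
    · exact hνneg
    · have h := combination ν ⟨hν.1, hν.2.le⟩ 0 ⟨by norm_num, le_rfl⟩ τ ⟨hgt, hτ.2⟩
      have := mul_neg_of_pos_of_neg (sub_pos.2 hτ.2) hνneg
      rw [c_zero, mul_zero] at h
      exact neg_of_mul_neg_right (by linarith) (sub_pos.2 hν.2).le
  refine ⟨τ₁, hτ₁mem, hzero, hpos, hneg, fun τ hτ h0 => ?_⟩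
  rcases lt_trichotomy τ τ₁ with h | h | h
  · exact absurd h0 (hpos τ ⟨hτ.1, h⟩).ne'
  · exact h
  · exact absurd h0 (hneg τ ⟨h, hτ.2⟩).ne
end
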